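/- arXiv:1908.06156 — 2 statements merged into one kernel-verified Lean document; each statement's English description precedes it below -/
import Mathlib

section
/- Let R ⊆ Gh(I) be a B-ring, p a prime, k = 𝔽_p, R̄ = R/pR, and fix i, j ∈ I. For l ≥ 1 let a_l = dim_k { x ∈ Ext^l_R(ℤ_i, ℤ_j) : px = 0 }, b_l = dim_k Ext^l_{R̄}(k_i, k_j), z_l = dim_k { x ∈ Tor^R_l(ℤ_i, ℤ_j) : px = 0 }, and y_l = dim_k Tor^{R̄}_l(k_i, k_j) (all of these are finite). Then a_{l+1} = b_l − a_l and z_l = y_{l+1} − z_{l+1} for every l ≥ 1. -/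
set_option synthInstance.maxHeartbeats 400000
set_option maxHeartbeats 1000000

noncomputable section

open CategoryTheory

/-- A subring `R ⊆ Gh I = ∏_{i ∈ I} ℤ` is a *B-ring* if for all distinct `i, j ∈ I`
there is `r ∈ R` with `r i ≠ 0` and `r j = 0`. -/
def IsBRing {I : Type*} (R : Subring (I → ℤ)) : Prop :=
  ∀ i j : I, i ≠ j → ∃ r ∈ R, r i ≠ 0 ∧ r j = 0

/-- The dimension over `𝔽_p` of the subgroup `{x ∈ A | p • x = 0}` of an abelian group `A`. -/
def pDim (p : ℕ) (A : Type*) [AddCommGroup A] : ℕ :=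
  letI := AddSubgroup.torsionBy.zmodModule (A := A) (n := p)
  Module.finrank (ZMod p) (AddSubgroup.torsionBy A p)

/-- `ℤ_i`: the `R`-module `ℤ` where `r ∈ R ⊆ ∏_{i ∈ I} ℤ` acts by multiplication by `r i`. -/
def ZInt {I : Type} (R : Subring (I → ℤ)) (i : I) : ModuleCat R :=
  letI : Module R ℤ := Module.compHom ℤ ((Pi.evalRingHom (fun _ => ℤ) i).comp R.subtype)
  ModuleCat.of R ℤ

variable {I : Type} (R : Subring (I → ℤ)) (p : ℕ)

/-- The ring homomorphism `R̄ = R/pR → 𝔽_p`, `r ↦ r i mod p`. -/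
def kiHom (i : I) : (R ⧸ Ideal.span {(p : R)}) →+* ZMod p := by
  refine Ideal.Quotient.lift _
    ((Int.castRingHom (ZMod p)).comp ((Pi.evalRingHom (fun _ => ℤ) i).comp R.subtype)) ?_
  have key : ((Int.castRingHom (ZMod p)).comp
      ((Pi.evalRingHom (fun _ => ℤ) i).comp R.subtype)) ((p : R)) = 0 := by
    simp [map_natCast]
  intro a ha
  rw [Ideal.mem_span_singleton] at ha
  obtain ⟨c, rfl⟩ := ha
  rw [map_mul, key, zero_mul]

/-- `k_i`: the `R̄ = R/pR`-module `𝔽_p` where `r` acts through multiplication by `r i mod p`. -/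
def ki (i : I) : ModuleCat (R ⧸ Ideal.span {(p : R)}) :=
  letI : Module (R ⧸ Ideal.span {(p : R)}) (ZMod p) := Module.compHom (ZMod p) (kiHom R p i)
  ModuleCat.of _ (ZMod p)

lemma card_torsionBy_eq_pow_pDim (p : ℕ) [Fact p.Prime] (A : Type*) [AddCommGroup A] [Finite A] :
    Nat.card (AddSubgroup.torsionBy A (p : ℤ)) = p ^ pDim p A := by
  let := AddSubgroup.torsionBy.zmodModule (A := A) (n := p)
  have h := Module.natCard_eq_pow_finrank (K := ZMod p) (V := AddSubgroup.torsionBy A (p : ℤ))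
  rwa [Nat.card_zmod] at h

/-- Multiplication by `n` on a finite abelian group has kernel and cokernel of the same size. -/
lemma card_torsionBy_eq_card_quotient {A : Type*} [AddCommGroup A] [Finite A] (n : ℕ) :
    Nat.card (AddSubgroup.torsionBy A (n : ℤ)) =
      Nat.card (A ⧸ (nsmulAddMonoidHom (α := A) n).range) := by
  have h1 := AddSubgroup.card_eq_card_quotient_mul_card_addSubgroup
    (nsmulAddMonoidHom (α := A) n).ker
  have h2 := AddSubgroup.card_eq_card_quotient_mul_card_addSubgroup
    (nsmulAddMonoidHom (α := A) n).range
  have h3 : Nat.card (A ⧸ (nsmulAddMonoidHom (α := A) n).ker) =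
      Nat.card (nsmulAddMonoidHom (α := A) n).range :=
    Nat.card_congr (QuotientAddGroup.quotientKerEquivRange _).toEquiv
  have h4 : AddSubgroup.torsionBy A (n : ℤ) = (nsmulAddMonoidHom (α := A) n).ker := by
    ext x
    simp [AddSubgroup.torsionBy, AddMonoidHom.mem_ker]
  rw [h4]
  have hpos : 0 < Nat.card (nsmulAddMonoidHom (α := A) n).range := Nat.card_pos
  rw [h3] at h1
  apply Nat.eq_of_mul_eq_mul_left hpos
  rw [← h1, h2, mul_comm]

lemma pDim_eq_add_of_exact {p : ℕ} (hp : p.Prime) {A B A' : Type*} [AddCommGroup A]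
    [AddCommGroup B] [AddCommGroup A'] [Finite A] [Finite A'] (f : A →+ B) (g : B →+ A')
    (hf : ∀ a, f a = 0 ↔ ∃ a', p • a' = a) (hfg : ∀ b, g b = 0 ↔ ∃ a, f a = b)
    (hg : ∀ a', p • a' = 0 ↔ ∃ b, g b = a') (hB : ∀ b : B, p • b = 0) :
    pDim p B = pDim p A + pDim p A' := by
  have : Fact p.Prime := ⟨hp⟩
  have hker : g.ker = f.range := by
    ext b
    simp [AddMonoidHom.mem_ker, hfg]
  have hfker : f.ker = (nsmulAddMonoidHom (α := A) p).range := by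
    ext b
    simp [AddMonoidHom.mem_ker, hf]
  have hrange : g.range = AddSubgroup.torsionBy A' (p : ℤ) := by
    ext a'
    simp [AddSubgroup.torsionBy, ← hg]
  have hBt : AddSubgroup.torsionBy B (p : ℤ) = ⊤ := by
    ext b
    simp [AddSubgroup.torsionBy, hB]
  have hcard : Nat.card B = p ^ (pDim p A + pDim p A') := by
    rw [AddSubgroup.card_eq_card_quotient_mul_card_addSubgroup g.ker,
      Nat.card_congr (QuotientAddGroup.quotientKerEquivRange g).toEquiv, hrange, hker,
      ← Nat.card_congr (QuotientAddGroup.quotientKerEquivRange f).toEquiv, hfker,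
      ← card_torsionBy_eq_card_quotient, card_torsionBy_eq_pow_pDim, card_torsionBy_eq_pow_pDim,
      pow_add, mul_comm]
  have : Finite B := Nat.finite_of_card_ne_zero (by simp [hcard, hp.ne_zero])
  have h := card_torsionBy_eq_pow_pDim p B
  rw [hBt, AddSubgroup.card_top, hcard] at h
  exact (Nat.pow_right_injective hp.two_le h).symm

open HomologicalComplex in
/-- The counting consequence of the universal coefficient theorem for the reduction `L` modulo `p`
of a complex `K` of torsion-free abelian groups. -/
lemma pDim_homology_reduction {p : ℕ} (hp : p.Prime) {ι : Type*} {c : ComplexShape ι}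
    {K L : HomologicalComplex (ModuleCat.{0} ℤ) c} (π : K ⟶ L)
    (hK : ∀ n (x : K.X n), p • x = 0 → x = 0)
    (hπ : ∀ n, Function.Surjective (π.f n))
    (hker : ∀ n (x : K.X n), (π.f n) x = 0 ↔ ∃ y, p • y = x)
    (i j : ι) (hij : c.Rel i j) [Finite (K.homology i)] [Finite (K.homology j)] :
    pDim p (L.homology i) = pDim p (K.homology i) + pDim p (K.homology j) := by
  let S : ShortComplex (HomologicalComplex (ModuleCat.{0} ℤ) c) :=
    ShortComplex.mk (p • 𝟙 K) π (by
      ext n x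
      simpa using (hker n _).2 ⟨x, rfl⟩)
  have hS : S.ShortExact := by
    apply HomologicalComplex.shortExact_of_degreewise_shortExact
    intro n
    refine ShortComplex.ShortExact.mk' ?_ ?_ ?_
    · rw [ShortComplex.moduleCat_exact_iff]
      intro x hx
      obtain ⟨y, hy⟩ := (hker n x).1 hx
      exact ⟨y, hy⟩
    · rw [ModuleCat.mono_iff_injective]
      exact (injective_iff_map_eq_zero _).2 fun x hx => hK n x hx
    · rw [ModuleCat.epi_iff_surjective]
      exact hπ n
  have hL : (p • 𝟙 L) = 0 := by
    ext n x
    obtain ⟨y, rfl⟩ := hπ n x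
    have := (hker n _).2 ⟨y, rfl⟩
    simpa using this
  have hmap (M : HomologicalComplex (ModuleCat.{0} ℤ) c) (k : ι) :
      homologyMap (p • 𝟙 M) k = p • 𝟙 (M.homology k) :=
    ((homologyFunctor _ c k).map_nsmul).trans
      (congrArg (p • ·) ((homologyFunctor _ c k).map_id M))
  have hmul (M : HomologicalComplex (ModuleCat.{0} ℤ) c) (k : ι) (x : M.homology k) :
      homologyMap (p • 𝟙 M) k x = p • x := by
    rw [hmap]
    rfl
  have e₁ (x : K.homology j) (hx : p • x = 0) : ∃ y, hS.δ i j hij y = x :=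
    (ShortComplex.moduleCat_exact_iff _).1 (hS.homology_exact₁ i j hij) x ((hmul K j x).trans hx)
  have e₂ (x : K.homology i) (hx : homologyMap π i x = 0) : ∃ y, p • y = x := by
    obtain ⟨y, hy⟩ := (ShortComplex.moduleCat_exact_iff _).1 (hS.homology_exact₂ i) x hx
    exact ⟨y, (hmul K i y).symm.trans hy⟩
  have e₃ (x : L.homology i) (hx : hS.δ i j hij x = 0) : ∃ y, homologyMap π i y = x :=
    (ShortComplex.moduleCat_exact_iff _).1 (hS.homology_exact₃ i j hij) x hx
  have hLp (x : L.homology i) : p • x = 0 := by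
    rw [← hmul, hL, homologyMap_zero]
    rfl
  refine pDim_eq_add_of_exact hp (homologyMap π i).hom.toAddMonoidHom
    (hS.δ i j hij).hom.toAddMonoidHom (fun x => ⟨e₂ x, ?_⟩) (fun x => ⟨e₃ x, ?_⟩)
    (fun x => ⟨e₁ x, ?_⟩) hLp
  · rintro ⟨y, rfl⟩
    exact (map_nsmul _ p y).trans (hLp _)
  · rintro ⟨y, rfl⟩
    exact ConcreteCategory.congr_hom (hS.comp_δ i j hij) y
  · rintro ⟨y, rfl⟩
    exact (map_nsmul _ p y).symm.trans ((congrArg _ (hLp y)).trans (map_zero _))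

lemma pDim_congr (p : ℕ) {A B : Type*} [AddCommGroup A] [AddCommGroup B] (e : A ≃+ B) :
    pDim p A = pDim p B := by
  let := AddSubgroup.torsionBy.zmodModule (A := A) (n := p)
  let := AddSubgroup.torsionBy.zmodModule (A := B) (n := p)
  let f : AddSubgroup.torsionBy A (p : ℤ) ≃+ AddSubgroup.torsionBy B (p : ℤ) :=
    e.addSubgroupMap _ |>.trans (AddEquiv.addSubgroupCongr (by
      ext x
      constructor
      · rintro ⟨y, hy, rfl⟩
        simp only [AddSubgroup.torsionBy] at hy ⊢
        simp_all [← map_nsmul]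
      · intro hx
        refine ⟨e.symm x, ?_, by simp⟩
        simp only [AddSubgroup.torsionBy] at hx ⊢
        simp_all [← map_nsmul]))
  exact LinearEquiv.finrank_eq
    { f with map_smul' := fun c x => ZMod.map_smul f.toAddMonoidHom c x }

/-- A projective resolution of a module from a degreewise projective complex with an augmentation
that is exact on elements. -/
def ModuleCat.projectiveResolutionOfExact {R : Type} [CommRing R] {M : ModuleCat.{0} R}
    (C : ChainComplex (ModuleCat.{0} R) ℕ) (hC : ∀ n, Projective (C.X n)) (ε : C.X 0 ⟶ M)
    (hε : Function.Surjective ε) (hdε : C.d 1 0 ≫ ε = 0)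
    (h₀ : ∀ x, ε x = 0 → ∃ y, C.d 1 0 y = x)
    (h : ∀ n x, C.d (n + 1) n x = 0 → ∃ y, C.d (n + 2) (n + 1) y = x) :
    ProjectiveResolution M where
  complex := C
  projective := hC
  π := (ChainComplex.toSingle₀Equiv _ _).symm ⟨ε, hdε⟩
  quasiIso := ⟨fun n => by
    cases n
    · rw [ChainComplex.quasiIsoAt₀_iff, ShortComplex.quasiIso_iff_of_zeros']
      · refine (ShortComplex.exact_and_epi_g_iff_of_iso (S₁ := ShortComplex.mk _ _ hdε) ?_).1
          ⟨(ShortComplex.moduleCat_exact_iff _).2 h₀, (ModuleCat.epi_iff_surjective _).2 hε⟩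
        exact ShortComplex.isoMk (Iso.refl _) (Iso.refl _) (Iso.refl _)
          ((Category.id_comp _).trans (Category.comp_id _).symm)
          ((Category.id_comp _).trans (Category.comp_id _).symm)
      · exact C.shape _ _ (by simp)
      all_goals rfl
    · rw [quasiIsoAt_iff_exactAt']
      · rw [HomologicalComplex.exactAt_iff' _ _ _ _ (ChainComplex.prev _ _)
          (ChainComplex.next_nat_succ _)]
        exact (ShortComplex.moduleCat_exact_iff _).2 (h _)
      · apply ChainComplex.exactAt_succ_single_obj⟩

section FiniteResolution

variable {R : Type} [CommRing R]

lemma ModuleCat.exists_finite_cover (Z : ModuleCat.{0} R) :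
    ∃ (n : ℕ) (f : ModuleCat.of R (Fin n → R) ⟶ Z),
      Module.Finite R Z → Function.Surjective f := by
  by_cases hZ : Module.Finite R Z
  · obtain ⟨n, f, hf⟩ := Module.Finite.exists_fin' R Z
    exact ⟨n, ModuleCat.ofHom f, fun _ => hf⟩
  · exact ⟨0, 0, fun h => absurd h hZ⟩

/-- A finite free module, mapping onto `Z` if `Z` is finite. -/
def ModuleCat.finiteCover (Z : ModuleCat.{0} R) : ModuleCat.{0} R :=
  ModuleCat.of R (Fin (exists_finite_cover Z).choose → R)

/-- The map from the finite free cover. -/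
def ModuleCat.finiteCoverπ (Z : ModuleCat.{0} R) : Z.finiteCover ⟶ Z :=
  (exists_finite_cover Z).choose_spec.choose

lemma ModuleCat.finiteCoverπ_surjective (Z : ModuleCat.{0} R) [Module.Finite R Z] :
    Function.Surjective Z.finiteCoverπ :=
  (exists_finite_cover Z).choose_spec.choose_spec inferInstance

/-- The differential of the finite free resolution covering the kernel of `f`. -/
def ModuleCat.finiteSyzygies {X Y : ModuleCat.{0} R} (f : X ⟶ Y) :
    (ModuleCat.of R f.hom.ker).finiteCover ⟶ X :=
  finiteCoverπ _ ≫ ModuleCat.ofHom f.hom.ker.subtype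

lemma ModuleCat.finiteSyzygies_comp {X Y : ModuleCat.{0} R} (f : X ⟶ Y) :
    finiteSyzygies f ≫ f = 0 := by
  ext x
  exact ((ModuleCat.of R f.hom.ker).finiteCoverπ x).2

lemma ModuleCat.finiteSyzygies_exact [IsNoetherianRing R] {X Y : ModuleCat.{0} R} (f : X ⟶ Y)
    (hX : Module.Finite R X) (x : X) (hx : f x = 0) : ∃ y, finiteSyzygies f y = x := by
  obtain ⟨y, hy⟩ := (ModuleCat.of R f.hom.ker).finiteCoverπ_surjective ⟨x, hx⟩
  exact ⟨y, congrArg Subtype.val hy⟩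

/-- The successive differentials of a resolution by finite free modules. -/
def ModuleCat.finiteFreeDifferentials (Z : ModuleCat.{0} R) : ℕ → Arrow (ModuleCat.{0} R)
  | 0 => Arrow.mk (finiteSyzygies Z.finiteCoverπ)
  | n + 1 => Arrow.mk (finiteSyzygies (finiteFreeDifferentials Z n).hom)

/-- The modules of a resolution by finite free modules. -/
def ModuleCat.finiteFreeX (Z : ModuleCat.{0} R) (n : ℕ) : ModuleCat.{0} R :=
  (Z.finiteFreeDifferentials n).right

/-- The differentials of a resolution by finite free modules. -/
def ModuleCat.finiteFreeD (Z : ModuleCat.{0} R) (n : ℕ) :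
    Z.finiteFreeX (n + 1) ⟶ Z.finiteFreeX n :=
  (Z.finiteFreeDifferentials n).hom

/-- A resolution by finite free modules over a noetherian ring. -/
def ModuleCat.finiteFreeComplex (Z : ModuleCat.{0} R) : ChainComplex (ModuleCat.{0} R) ℕ :=
  ChainComplex.of Z.finiteFreeX Z.finiteFreeD
    (fun n => finiteSyzygies_comp (Z.finiteFreeD n))

lemma ModuleCat.finiteFreeComplex_d (Z : ModuleCat.{0} R) (n : ℕ) :
    Z.finiteFreeComplex.d (n + 1) n = Z.finiteFreeD n :=
  ChainComplex.of_d _ _ n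

lemma ModuleCat.finiteFreeComplex_X (Z : ModuleCat.{0} R) (n : ℕ) :
    ∃ Y : ModuleCat.{0} R, Z.finiteFreeComplex.X n = Y.finiteCover := by
  obtain (_ | _ | n) := n <;> exact ⟨_, rfl⟩

instance (Z : ModuleCat.{0} R) (n : ℕ) : Module.Free R (Z.finiteFreeComplex.X n) := by
  obtain ⟨Y, hY⟩ := Z.finiteFreeComplex_X n
  rw [hY]
  exact Module.Free.function _ _ _

instance (Z : ModuleCat.{0} R) (n : ℕ) : Module.Finite R (Z.finiteFreeComplex.X n) := by
  obtain ⟨Y, hY⟩ := Z.finiteFreeComplex_X n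
  rw [hY]
  exact Module.Finite.pi

lemma ModuleCat.finiteFreeComplex_exact [IsNoetherianRing R] (Z : ModuleCat.{0} R) (n : ℕ)
    (x) (hx : Z.finiteFreeComplex.d (n + 1) n x = 0) :
    ∃ y, Z.finiteFreeComplex.d (n + 2) (n + 1) y = x := by
  rw [finiteFreeComplex_d] at hx ⊢
  exact finiteSyzygies_exact _ (inferInstanceAs (Module.Finite R (Z.finiteFreeComplex.X (n + 1))))
    x hx

lemma ModuleCat.exists_projectiveResolution_finite [IsNoetherianRing R] (Z : ModuleCat.{0} R)
    [Module.Finite R Z] :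
    ∃ P : ProjectiveResolution Z, ∀ n, Module.Finite R (P.complex.X n) := by
  refine ⟨projectiveResolutionOfExact Z.finiteFreeComplex
    (fun n => (IsProjective.iff_projective _).1
      (inferInstanceAs (Module.Projective R (Z.finiteFreeComplex.X n)))) Z.finiteCoverπ
    Z.finiteCoverπ_surjective ?_ ?_ Z.finiteFreeComplex_exact, fun n => ?_⟩
  · rw [finiteFreeComplex_d]
    exact finiteSyzygies_comp _
  · rw [finiteFreeComplex_d]
    exact finiteSyzygies_exact _ (inferInstanceAs (Module.Finite R (Fin _ → R)))
  · exact inferInstanceAs (Module.Finite R (Z.finiteFreeComplex.X n))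

end FiniteResolution

open TensorProduct in
lemma eq_zero_of_nsmul_eq_zero_tensorProduct {R M N : Type} [CommRing R] [AddCommGroup M]
    [AddCommGroup N] [Module R M] [Module R N] [Module.Flat R N] (p : ℕ)
    (hM : ∀ x : M, p • x = 0 → x = 0) (x : M ⊗[R] N) (hx : p • x = 0) : x = 0 := by
  let f : M →ₗ[R] M := LinearMap.lsmul R M (p : R)
  have hf : Function.Injective f :=
    (injective_iff_map_eq_zero f).2 fun m hm => hM m (by
      simpa [f, Nat.cast_smul_eq_nsmul] using hm)
  have hfN := Module.Flat.rTensor_preserves_injective_linearMap (M := N) f hf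
  have hmul : f.rTensor N = LinearMap.lsmul R (M ⊗[R] N) (p : R) := by
    ext m n
    simp [f, smul_tmul']
  refine (injective_iff_map_eq_zero _).1 hfN x ?_
  rw [hmul, LinearMap.lsmul_apply, Nat.cast_smul_eq_nsmul, hx]

lemma Module.Flat.eq_zero_of_nsmul_eq_zero {R N : Type} [CommRing R] [AddCommGroup N]
    [Module R N] [Module.Flat R N] (p : ℕ) (hR : ∀ r : R, p • r = 0 → r = 0) (x : N)
    (hx : p • x = 0) : x = 0 := by
  rw [← (TensorProduct.lid R N).symm.map_eq_zero_iff]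
  refine eq_zero_of_nsmul_eq_zero_tensorProduct p hR _ ?_
  rw [← map_nsmul, hx, map_zero]

section BaseChange

variable {R S : Type} [CommRing R] [CommRing S] (φ : R →+* S) {p : ℕ}

instance : (ModuleCat.extendScalars.{0} φ).Additive :=
  (ModuleCat.extendRestrictScalarsAdj φ).left_adjoint_additive

/-- The additive map `x ↦ 1 ⊗ x` from a module to its extension of scalars. -/
def ModuleCat.toExtendScalars (M : ModuleCat.{0} R) : M →+ (ModuleCat.extendScalars φ).obj M :=
  ((ModuleCat.extendRestrictScalarsAdj φ).unit.app M).hom.toAddMonoidHom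

lemma ModuleCat.toExtendScalars_naturality {M N : ModuleCat.{0} R} (f : M ⟶ N) (x : M) :
    (ModuleCat.extendScalars φ).map f (toExtendScalars φ M x) = toExtendScalars φ N (f x) :=
  (ConcreteCategory.congr_hom ((ModuleCat.extendRestrictScalarsAdj φ).unit.naturality f) x).symm

lemma ModuleCat.toExtendScalars_smul (M : ModuleCat.{0} R) (r : R) (x : M) :
    toExtendScalars φ M (r • x) = φ r • toExtendScalars φ M x :=
  ((ModuleCat.extendRestrictScalarsAdj φ).unit.app M).hom.map_smul r x

variable {φ}

lemma ModuleCat.toExtendScalars_surjective (hφ : Function.Surjective φ) (M : ModuleCat.{0} R) :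
    Function.Surjective (toExtendScalars φ M) := by
  let := φ.toAlgebra
  exact TensorProduct.mk_surjective R M S hφ

lemma ModuleCat.toExtendScalars_eq_zero_iff (hφ : Function.Surjective φ)
    (hker : ∀ r, φ r = 0 ↔ ∃ s, p * s = r) (M : ModuleCat.{0} R) (x : M) :
    toExtendScalars φ M x = 0 ↔ ∃ y, p • y = x := by
  let := φ.toAlgebra
  have hex : Function.Exact (LinearMap.mulLeft R (p : R)) (Algebra.linearMap R S) := by
    intro r
    exact hker r
  have hex' := rTensor_exact M hex hφ
  constructor
  · intro hx
    obtain ⟨y, hy⟩ := (hex' ((1 : R) ⊗ₜ x)).1 (by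
      rw [LinearMap.rTensor_tmul]
      refine Eq.trans ?_ hx
      change (algebraMap R S 1) ⊗ₜ[R] x = (1 : S) ⊗ₜ[R] x
      rw [map_one])
    refine ⟨TensorProduct.lid R M y, ?_⟩
    have h := congrArg (TensorProduct.lid R M) hy
    rw [TensorProduct.lid_tmul, one_smul] at h
    rw [← h, ← Nat.cast_smul_eq_nsmul R]
    clear h hy
    induction y with
    | zero => simp
    | tmul r m => simp [mul_smul]
    | add a b ha hb => simp [ha, hb]
  · rintro ⟨y, rfl⟩
    rw [← Nat.cast_smul_eq_nsmul R, toExtendScalars_smul, (hker _).2 ⟨1, mul_one _⟩, zero_smul]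

lemma exists_projectiveResolution_extendScalars (hφ : Function.Surjective φ)
    (hker : ∀ r, φ r = 0 ↔ ∃ s, p * s = r) {M : ModuleCat.{0} R} {M' : ModuleCat.{0} S}
    (hpM : ∀ x : M, p • x = 0 → x = 0)
    (μ : M ⟶ (ModuleCat.restrictScalars φ).obj M')
    (hμ : Function.Surjective μ) (hμker : ∀ x, μ x = 0 ↔ ∃ y, p • y = x)
    (hpR : ∀ r : R, p • r = 0 → r = 0)
    (P : ProjectiveResolution M) :
    ∃ Q : ProjectiveResolution M',
      Q.complex = ((ModuleCat.extendScalars φ).mapHomologicalComplex _).obj P.complex := by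
  let q (n : ℕ) := ModuleCat.toExtendScalars φ (P.complex.X n)
  have hq (n : ℕ) := ModuleCat.toExtendScalars_surjective hφ (P.complex.X n)
  have hqker (n : ℕ) := ModuleCat.toExtendScalars_eq_zero_iff hφ hker (P.complex.X n)
  have hP (n : ℕ) (x : P.complex.X n) (hx : p • x = 0) : x = 0 := by
    have := (IsProjective.iff_projective (P.complex.X n)).2 (P.projective n)
    exact Module.Flat.eq_zero_of_nsmul_eq_zero p hpR x hx
  have hε₀ (x : P.complex.X 0) (hx : P.π.f 0 x = 0) : ∃ y, P.complex.d 1 0 y = x :=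
    (ShortComplex.moduleCat_exact_iff _).1 P.exact₀ x hx
  have hεs : Function.Surjective (P.π.f 0) := (ModuleCat.epi_iff_surjective _).1 inferInstance
  have hdd (n : ℕ) (x) : P.complex.d (n + 1) n (P.complex.d (n + 2) (n + 1) x) = 0 :=
    ConcreteCategory.congr_hom (P.complex.d_comp_d (n + 2) (n + 1) n) x
  have hεd (x) : P.π.f 0 (P.complex.d 1 0 x) = 0 :=
    ConcreteCategory.congr_hom P.complex_d_comp_π_f_zero x
  have hex (n : ℕ) (x) (hx : P.complex.d (n + 1) n x = 0) :
      ∃ y, P.complex.d (n + 2) (n + 1) y = x :=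
    (ShortComplex.moduleCat_exact_iff _).1 (P.exact_succ n) x hx
  have hnat (i j : ℕ) (x : P.complex.X i) :
      (ModuleCat.extendScalars φ).map (P.complex.d i j) (q i x) = q j (P.complex.d i j x) :=
    ModuleCat.toExtendScalars_naturality φ _ x
  let ε' : (ModuleCat.extendScalars φ).obj (P.complex.X 0) ⟶ M' :=
    ((ModuleCat.extendRestrictScalarsAdj φ).homEquiv _ _).symm (P.π.f 0 ≫ μ)
  have hε' (x : P.complex.X 0) : ε' (q 0 x) = μ (P.π.f 0 x) :=
    ConcreteCategory.congr_hom
      (((ModuleCat.extendRestrictScalarsAdj φ).homEquiv _ _).apply_symm_apply (P.π.f 0 ≫ μ)) x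
  refine ⟨ModuleCat.projectiveResolutionOfExact
    (((ModuleCat.extendScalars φ).mapHomologicalComplex _).obj P.complex) ?_ ε' ?_ ?_ ?_ ?_, rfl⟩
  · exact fun n => (ModuleCat.extendRestrictScalarsAdj φ).map_projective _ (P.projective n)
  · intro m
    obtain ⟨m, rfl⟩ := hμ m
    obtain ⟨x, rfl⟩ := hεs m
    exact ⟨_, hε' x⟩
  · ext x
    obtain ⟨x, rfl⟩ := hq 1 x
    change ε' ((ModuleCat.extendScalars φ).map (P.complex.d 1 0) (q 1 x)) = 0
    rw [hnat, hε', hεd]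
    exact map_zero _
  · intro x hx
    obtain ⟨x, rfl⟩ := hq 0 x
    obtain ⟨m, hm⟩ := (hμker _).1 ((hε' x).symm.trans hx)
    obtain ⟨w, rfl⟩ := hεs m
    obtain ⟨v, hv⟩ := hε₀ (x - p • w) (by rw [map_sub, map_nsmul]; exact sub_eq_zero.2 hm.symm)
    refine ⟨q 1 v, (hnat 1 0 v).trans ?_⟩
    rw [hv, map_sub, (hqker 0 _).2 ⟨w, rfl⟩, sub_zero]
  · intro n x hx
    obtain ⟨x, rfl⟩ := hq (n + 1) x
    obtain ⟨y, hy⟩ := (hqker n _).1 ((hnat (n + 1) n x).symm.trans hx)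
    obtain ⟨w, rfl⟩ : ∃ w, P.complex.d (n + 1) n w = y := by
      cases n with
      | zero =>
        apply hε₀
        apply hpM
        have h := congrArg (P.π.f 0) hy
        rw [map_nsmul, hεd] at h
        exact h
      | succ n =>
        apply hex
        apply hP
        rw [← map_nsmul, hy, hdd]
    obtain ⟨v, hv⟩ := hex n (x - p • w) (by rw [map_sub, map_nsmul, hy, sub_self])
    refine ⟨q (n + 2) v, (hnat (n + 2) (n + 1) v).trans ?_⟩
    rw [hv, map_sub, (hqker (n + 1) _).2 ⟨w, rfl⟩, sub_zero]

end BaseChange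

section ExtReduction

variable {R S : Type} [CommRing R] [CommRing S] {φ : R →+* S} {p : ℕ}

/-- The morphism of Hom complexes induced by a map `N ⟶ N'` along extension of scalars. -/
def linearYonedaObjReduction (C : ChainComplex (ModuleCat.{0} R) ℕ) {N : ModuleCat.{0} R}
    {N' : ModuleCat.{0} S} (ν : N ⟶ (ModuleCat.restrictScalars φ).obj N') :
    C.linearYonedaObj ℤ N ⟶
      ChainComplex.linearYonedaObj (((ModuleCat.extendScalars φ).mapHomologicalComplex _).obj C)
        ℤ N' where
  f n := ModuleCat.ofHom (AddMonoidHom.toIntLinearMap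
    (((ModuleCat.extendRestrictScalarsAdj φ).homAddEquiv (C.X n) N').symm.toAddMonoidHom.comp
      (Preadditive.rightComp (C.X n) ν)))
  comm' i j hij := by
    ext (f : C.X i ⟶ N)
    exact (((ModuleCat.extendRestrictScalarsAdj φ).homEquiv_naturality_left_symm
      (C.d j i) (f ≫ ν)).symm)

lemma pDim_Ext_reduction (hp : p.Prime) (hφ : Function.Surjective φ)
    (hker : ∀ r, φ r = 0 ↔ ∃ s, p * s = r) (hpR : ∀ r : R, p • r = 0 → r = 0)
    {M N : ModuleCat.{0} R} {M' N' : ModuleCat.{0} S}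
    (hpM : ∀ x : M, p • x = 0 → x = 0) (hpN : ∀ x : N, p • x = 0 → x = 0)
    (μ : M ⟶ (ModuleCat.restrictScalars φ).obj M')
    (hμ : Function.Surjective μ) (hμker : ∀ x, μ x = 0 ↔ ∃ y, p • y = x)
    (ν : N ⟶ (ModuleCat.restrictScalars φ).obj N')
    (hν : Function.Surjective ν) (hνker : ∀ x, ν x = 0 ↔ ∃ y, p • y = x) (l : ℕ)
    [Finite (((Ext ℤ (ModuleCat.{0} R) l).obj (Opposite.op M)).obj N)]
    [Finite (((Ext ℤ (ModuleCat.{0} R) (l + 1)).obj (Opposite.op M)).obj N)] :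
    pDim p (((Ext ℤ (ModuleCat.{0} S) l).obj (Opposite.op M')).obj N') =
      pDim p (((Ext ℤ (ModuleCat.{0} R) l).obj (Opposite.op M)).obj N) +
      pDim p (((Ext ℤ (ModuleCat.{0} R) (l + 1)).obj (Opposite.op M)).obj N) := by
  let P := projectiveResolution M
  obtain ⟨Q, hQ⟩ := exists_projectiveResolution_extendScalars hφ hker hpM μ hμ hμker hpR P
  have eP (n : ℕ) := (P.isoExt (R := ℤ) n N).toLinearEquiv
  have eQ := (Q.isoExt (R := ℤ) l N').toLinearEquiv
  rw [hQ] at eQ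
  have := Finite.of_equiv _ (eP l).toEquiv
  have := Finite.of_equiv _ (eP (l + 1)).toEquiv
  rw [pDim_congr p eQ.toAddEquiv, pDim_congr p (eP l).toAddEquiv,
    pDim_congr p (eP (l + 1)).toAddEquiv]
  refine pDim_homology_reduction hp (linearYonedaObjReduction P.complex ν) ?_ ?_ ?_ l (l + 1) rfl
  · intro n (f : P.complex.X n ⟶ N) hf
    refine show f = 0 from ?_
    ext x
    exact hpN _ (ConcreteCategory.congr_hom (show p • f = 0 from hf) x)
  · intro n (f : (ModuleCat.extendScalars φ).obj (P.complex.X n) ⟶ N')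
    have : Epi ν := (ModuleCat.epi_iff_surjective _).2 hν
    refine ⟨Projective.factorThru ((ModuleCat.extendRestrictScalarsAdj φ).homEquiv _ _ f) ν, ?_⟩
    change ((ModuleCat.extendRestrictScalarsAdj φ).homEquiv _ _).symm (_ ≫ ν) = f
    rw [Projective.factorThru_comp, Equiv.symm_apply_apply]
  · intro n (f : P.complex.X n ⟶ N)
    have key : (linearYonedaObjReduction P.complex ν).f n f = 0 ↔ f ≫ ν = 0 :=
      ((ModuleCat.extendRestrictScalarsAdj φ).homAddEquiv (P.complex.X n) N').symm.map_eq_zero_iff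
    rw [key]
    have hpν : (p • 𝟙 N) ≫ ν = 0 := by
      ext x
      exact (hνker _).2 ⟨x, rfl⟩
    have hex : (ShortComplex.mk _ _ hpν).Exact :=
      (ShortComplex.moduleCat_exact_iff _).2 fun x hx => (hνker x).1 hx
    constructor
    · intro hf
      have h : hex.liftFromProjective f hf ≫ (p • 𝟙 N) = f := hex.liftFromProjective_comp f hf
      rw [Preadditive.comp_nsmul, Category.comp_id] at h
      exact ⟨_, h⟩
    · rintro ⟨g, hg⟩
      have hg : p • (show P.complex.X n ⟶ N from g) = f := hg
      rw [← hg, ← Category.comp_id (p • _), Preadditive.nsmul_comp, ← Preadditive.comp_nsmul,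
        Category.assoc, hpν, Limits.comp_zero]

end ExtReduction

section TensorReduction

open TensorProduct

variable {R S M M' N N' : Type} [CommRing R] [CommRing S] [Algebra R S]
  [AddCommGroup M] [AddCommGroup N] [AddCommGroup M'] [AddCommGroup N'] [Module R M] [Module R N]
  [Module R M'] [Module R N'] [Module S M'] [Module S N'] [IsScalarTower R S M']
  [IsScalarTower R S N'] {p : ℕ}

/-- The map induced by `f` and `g` between tensor products over different base rings. -/
def tensorReduction (f : M →ₗ[R] M') (g : N →ₗ[R] N') : M ⊗[R] N →ₗ[R] M' ⊗[S] N' :=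
  mapOfCompatibleSMul S R R M' N' ∘ₗ TensorProduct.map f g

lemma tensorReduction_surjective (f : M →ₗ[R] M') (g : N →ₗ[R] N') (hf : Function.Surjective f)
    (hg : Function.Surjective g) : Function.Surjective (tensorReduction (S := S) f g) :=
  (mapOfCompatibleSMul_surjective S R R M' N').comp (TensorProduct.map_surjective hf hg)

lemma tensorReduction_eq_zero_iff (hS : Function.Surjective (algebraMap R S))
    (f : M →ₗ[R] M') (g : N →ₗ[R] N') (hf : Function.Surjective f)
    (hg : Function.Surjective g) (hfker : ∀ x, f x = 0 ↔ ∃ y, p • y = x)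
    (hgker : ∀ x, g x = 0 ↔ ∃ y, p • y = x) (x : M ⊗[R] N) :
    tensorReduction (S := S) f g x = 0 ↔ ∃ y, p • y = x := by
  have : CompatibleSMul R S M' N' := ⟨fun s m n => by
    obtain ⟨r, rfl⟩ := hS s
    rw [algebraMap_smul, algebraMap_smul, smul_tmul]⟩
  have hinj : Function.Injective (mapOfCompatibleSMul S R R M' N') :=
    (equivOfCompatibleSMul S R R M' N').injective
  have hf' : Function.Exact (p • LinearMap.id : M →ₗ[R] M) f := hfker
  have hg' : Function.Exact (p • LinearMap.id : N →ₗ[R] N) g := hgker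
  change mapOfCompatibleSMul S R R M' N' (TensorProduct.map f g x) = 0 ↔ _
  rw [map_eq_zero_iff _ hinj, ← LinearMap.mem_ker, TensorProduct.map_ker hf' hf hg' hg]
  have h₁ : (p • LinearMap.id : N →ₗ[R] N).lTensor M = p • LinearMap.id := by
    ext; simp
  have h₂ : (p • LinearMap.id : M →ₗ[R] M).rTensor N = p • LinearMap.id := by
    ext; simp [smul_tmul']
  rw [h₁, h₂, sup_idem]
  rfl

end TensorReduction

section TorReduction

variable {R S : Type} [CommRing R] [CommRing S] {φ : R →+* S} {p : ℕ}

/-- A complex of modules as a complex of abelian groups. -/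
abbrev ModuleCat.intComplex {R : Type} [CommRing R] {ι : Type} {c : ComplexShape ι}
    (K : HomologicalComplex (ModuleCat.{0} R) c) : HomologicalComplex (ModuleCat.{0} ℤ) c :=
  ((ModuleCat.restrictScalars (Int.castRingHom R)).mapHomologicalComplex c).obj K

/-- The homology of a complex of modules agrees with that of the underlying complex of abelian
groups. -/
def ModuleCat.intComplexHomologyEquiv {ι : Type} {c : ComplexShape ι}
    (K : HomologicalComplex (ModuleCat.{0} R) c) (n : ι) :
    (ModuleCat.intComplex K).homology n ≃+ K.homology n :=
  ((K.sc n).mapHomologyIso (ModuleCat.restrictScalars (Int.castRingHom R))).toLinearEquiv.toAddEquiv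

/-- The complex of abelian groups `M ⊗ C`. -/
abbrev ModuleCat.tensorComplex {R : Type} [CommRing R] (M : ModuleCat.{0} R)
    (C : ChainComplex (ModuleCat.{0} R) ℕ) : ChainComplex (ModuleCat.{0} ℤ) ℕ :=
  ModuleCat.intComplex
    ((((MonoidalCategory.tensoringLeft (ModuleCat.{0} R)).obj M).mapHomologicalComplex _).obj C)

/-- `Tor` computed by a projective resolution of the second argument. -/
def torEquiv (M : ModuleCat.{0} R) {N : ModuleCat.{0} R} (P : ProjectiveResolution N) (n : ℕ) :
    ((Tor (ModuleCat.{0} R) n).obj M).obj N ≃+ (M.tensorComplex P.complex).homology n :=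
  (P.isoLeftDerivedObj ((MonoidalCategory.tensoringLeft _).obj M) n).toLinearEquiv.toAddEquiv.trans
    (ModuleCat.intComplexHomologyEquiv _ n).symm

/-- An additive map as a morphism of `ℤ`-modules. -/
def ModuleCat.ofAddMonoidHom {A B : ModuleCat.{0} ℤ} (f : A →+ B) : A ⟶ B :=
  ModuleCat.ofHom
    { f with
      map_smul' := fun n x => (congrArg f (int_smul_eq_zsmul _ n x)).trans
        ((map_zsmul f n x).trans (int_smul_eq_zsmul _ n (f x)).symm) }

open TensorProduct in
lemma exists_tensorExtendScalars (hφ : Function.Surjective φ)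
    (hker : ∀ r, φ r = 0 ↔ ∃ s, p * s = r) (N : ModuleCat.{0} R) {M : ModuleCat.{0} R}
    {M' : ModuleCat.{0} S} (μ : M ⟶ (ModuleCat.restrictScalars φ).obj M')
    (hμ : Function.Surjective μ) (hμker : ∀ x, μ x = 0 ↔ ∃ y, p • y = x) :
    ∃ f : M ⊗[R] N →+ M' ⊗[S] (ModuleCat.extendScalars φ).obj N,
      (∀ m n, f (m ⊗ₜ n) = (show M' from μ m) ⊗ₜ ModuleCat.toExtendScalars φ N n) ∧
      Function.Surjective f ∧ ∀ x, f x = 0 ↔ ∃ y, p • y = x := by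
  let N' := (ModuleCat.extendScalars φ).obj N
  let := φ.toAlgebra
  let : Module R M' := Module.compHom M' φ
  let : Module R N' := Module.compHom _ φ
  have : IsScalarTower R S M' := ⟨fun r s x => mul_smul (φ r) s x⟩
  have : IsScalarTower R S N' := ⟨fun r s x => mul_smul (φ r) s x⟩
  let f : M →ₗ[R] M' := μ.hom
  let g : N →ₗ[R] N' := ((ModuleCat.extendRestrictScalarsAdj φ).unit.app N).hom
  have hg : Function.Surjective g := ModuleCat.toExtendScalars_surjective hφ N
  exact ⟨(tensorReduction (S := S) f g).toAddMonoidHom, fun m n => rfl,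
    tensorReduction_surjective f g hμ hg,
    tensorReduction_eq_zero_iff hφ f g hμ hg hμker
      (ModuleCat.toExtendScalars_eq_zero_iff hφ hker N)⟩

open TensorProduct in
lemma pDim_Tor_reduction (hp : p.Prime) (hφ : Function.Surjective φ)
    (hker : ∀ r, φ r = 0 ↔ ∃ s, p * s = r) (hpR : ∀ r : R, p • r = 0 → r = 0)
    {M N : ModuleCat.{0} R} {M' N' : ModuleCat.{0} S}
    (hpM : ∀ x : M, p • x = 0 → x = 0) (hpN : ∀ x : N, p • x = 0 → x = 0)
    (μ : M ⟶ (ModuleCat.restrictScalars φ).obj M')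
    (hμ : Function.Surjective μ) (hμker : ∀ x, μ x = 0 ↔ ∃ y, p • y = x)
    (ν : N ⟶ (ModuleCat.restrictScalars φ).obj N')
    (hν : Function.Surjective ν) (hνker : ∀ x, ν x = 0 ↔ ∃ y, p • y = x) (l : ℕ)
    [Finite (((Tor (ModuleCat.{0} R) l).obj M).obj N)]
    [Finite (((Tor (ModuleCat.{0} R) (l + 1)).obj M).obj N)] :
    pDim p (((Tor (ModuleCat.{0} S) (l + 1)).obj M').obj N') =
      pDim p (((Tor (ModuleCat.{0} R) (l + 1)).obj M).obj N) +
      pDim p (((Tor (ModuleCat.{0} R) l).obj M).obj N) := by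
  let P := projectiveResolution N
  obtain ⟨Q, hQ⟩ := exists_projectiveResolution_extendScalars hφ hker hpN ν hν hνker hpR P
  have eP (n : ℕ) := torEquiv M P n
  have eQ := torEquiv M' Q (l + 1)
  rw [hQ] at eQ
  have := Finite.of_equiv _ (eP l).toEquiv
  have := Finite.of_equiv _ (eP (l + 1)).toEquiv
  rw [pDim_congr p eQ, pDim_congr p (eP l), pDim_congr p (eP (l + 1))]
  choose f hf hfs hfker using fun n =>
    exists_tensorExtendScalars hφ hker (P.complex.X n) μ hμ hμker
  let π : M.tensorComplex P.complex ⟶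
      M'.tensorComplex (((ModuleCat.extendScalars φ).mapHomologicalComplex _).obj P.complex) :=
    { f := fun n => ModuleCat.ofAddMonoidHom (f n)
      comm' := fun i j _ => by
        ext x
        induction x using TensorProduct.induction_on with
        | zero => exact (map_zero _).trans (map_zero _).symm
        | add x y hx hy =>
          exact (map_add _ _ _).trans ((congrArg₂ _ hx hy).trans (map_add _ _ _).symm)
        | tmul m n =>
          refine (congrArg _ (hf i m n)).trans (Eq.trans ?_ (hf j m _).symm)
          exact congrArg (_ ⊗ₜ[S] ·) (ModuleCat.toExtendScalars_naturality φ _ n) }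
  refine pDim_homology_reduction hp π ?_ hfs hfker (l + 1) l rfl
  intro n x hx
  have := (IsProjective.iff_projective (P.complex.X n)).2 (P.projective n)
  exact eq_zero_of_nsmul_eq_zero_tensorProduct (N := P.complex.X n) p hpM x hx

end TorReduction

section Finiteness

lemma leftDerived_zsmul_id_eq_zero {C D : Type*} [Category* C] [Category* D] [Abelian C]
    [HasProjectiveResolutions C] [Abelian D] (F : C ⥤ D) [F.Additive] {X Y : C} [Projective Y]
    (s : X ⟶ Y) (t : Y ⟶ X) (k : ℤ) (hst : s ≫ t = k • 𝟙 X) (n : ℕ) :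
    k • 𝟙 ((F.leftDerived (n + 1)).obj X) = 0 := by
  let P := projectiveResolution X
  have h := F.leftDerived_map_eq (n + 1) (k • 𝟙 X) (P := P) (Q := P) (k • 𝟙 P.complex)
    (by rw [Preadditive.zsmul_comp, Category.id_comp, Functor.map_zsmul,
      CategoryTheory.Functor.map_id, Preadditive.comp_zsmul, Category.comp_id])
  rw [Functor.map_zsmul (F.mapHomologicalComplex _ ⋙ HomologicalComplex.homologyFunctor _ _ _),
    CategoryTheory.Functor.map_id, Preadditive.zsmul_comp, Preadditive.comp_zsmul] at h
  have hid : (P.isoLeftDerivedObj F (n + 1)).hom ≫ 𝟙 _ ≫ (P.isoLeftDerivedObj F (n + 1)).inv =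
      𝟙 ((F.leftDerived (n + 1)).obj X) :=
    (congrArg _ (Category.id_comp _)).trans (Iso.hom_inv_id _)
  rw [← h.trans (congrArg (k • ·) hid), ← hst, Functor.map_comp,
    (F.isZero_leftDerived_obj_projective_succ n Y).eq_of_tgt ((F.leftDerived (n + 1)).map s) 0,
    Limits.zero_comp]

lemma Ext_zsmul_eq_zero {R : Type} [CommRing R] {M F : ModuleCat.{0} R} [Projective F]
    (s : M ⟶ F) (t : F ⟶ M) (k : ℤ) (hst : s ≫ t = k • 𝟙 M) (N : ModuleCat.{0} R) (n : ℕ)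
    (x : ((Ext ℤ (ModuleCat.{0} R) (n + 1)).obj (Opposite.op M)).obj N) : k • x = 0 := by
  have h := leftDerived_zsmul_id_eq_zero ((linearYoneda ℤ (ModuleCat.{0} R)).obj N).rightOp s t k
    hst n
  exact ConcreteCategory.congr_hom (congrArg Quiver.Hom.unop h) x

lemma Tor_zsmul_eq_zero {R : Type} [CommRing R] {N F : ModuleCat.{0} R} [Projective F]
    (s : N ⟶ F) (t : F ⟶ N) (k : ℤ) (hst : s ≫ t = k • 𝟙 N) (M : ModuleCat.{0} R) (n : ℕ)
    (x : ((Tor (ModuleCat.{0} R) (n + 1)).obj M).obj N) : k • x = 0 :=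
  ConcreteCategory.congr_hom (leftDerived_zsmul_id_eq_zero
    ((MonoidalCategory.tensoringLeft (ModuleCat.{0} R)).obj M) s t k hst n) x

lemma Module.Finite.int {A : Type} [AddCommGroup A] (h : Module.Finite ℤ A) (m : Module ℤ A) :
    @Module.Finite ℤ A _ _ m := by
  rwa [Subsingleton.elim m (AddCommGroup.toIntModule A)]

lemma Module.finite_homology {ι : Type} {c : ComplexShape ι}
    (K : HomologicalComplex (ModuleCat.{0} ℤ) c) (n : ι) [Module.Finite ℤ (K.X n)] :
    Module.Finite ℤ (K.homology n) := by
  have : Module.Finite ℤ (K.cycles n) :=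
    Module.Finite.of_injective (K.iCycles n).hom ((ModuleCat.mono_iff_injective _).1 inferInstance)
  exact Module.Finite.of_surjective (K.homologyπ n).hom
    ((ModuleCat.epi_iff_surjective _).1 inferInstance)

lemma finite_of_addEquiv_homology {ι : Type} {c : ComplexShape ι}
    (K : HomologicalComplex (ModuleCat.{0} ℤ) c) (n : ι) [Module.Finite ℤ (K.X n)] {A : Type}
    [AddCommGroup A] (e : A ≃+ K.homology n) (k : ℤ) (hk : k ≠ 0) (hA : ∀ x : A, k • x = 0) :
    Finite A := by
  have := Module.finite_homology K n
  have : Finite (K.homology n) := Module.finite_of_fg_torsion _ fun x =>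
    ⟨⟨k, mem_nonZeroDivisors_of_ne_zero hk⟩, by
      obtain ⟨a, rfl⟩ := e.surjective x
      exact (int_smul_eq_zsmul _ k (e a)).trans (by rw [← map_zsmul, hA, map_zero])⟩
  exact Finite.of_equiv _ e.symm.toEquiv

variable {R : Type} [CommRing R] [Module.Finite ℤ R] {M N F : ModuleCat.{0} R} [Module.Finite R M]
  [Module.Finite R N] [Projective F]

lemma finite_Ext_succ (s : M ⟶ F) (t : F ⟶ M) (k : ℤ) (hk : k ≠ 0) (hst : s ≫ t = k • 𝟙 M)
    (n : ℕ) : Finite (((Ext ℤ (ModuleCat.{0} R) (n + 1)).obj (Opposite.op M)).obj N) := by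
  have : IsNoetherianRing R := isNoetherian_of_tower ℤ inferInstance
  obtain ⟨P, hP⟩ := M.exists_projectiveResolution_finite
  have : Module.Finite ℤ ((P.complex.linearYonedaObj ℤ N).X (n + 1)) := by
    obtain ⟨m, f, hf⟩ := Module.Finite.exists_fin' R (P.complex.X (n + 1))
    have := Module.Finite.trans (R := ℤ) R N
    let g : (P.complex.X (n + 1) ⟶ N) →+ (Fin m → N) :=
      { toFun := fun h k => h (f (Pi.single k 1))
        map_zero' := rfl
        map_add' := fun _ _ => rfl }
    refine Module.Finite.of_injective g.toIntLinearMap fun h₁ h₂ h => ?_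
    refine ModuleCat.hom_ext ((LinearMap.cancel_right hf).1 ?_)
    ext k
    exact congrFun h k
  exact finite_of_addEquiv_homology _ (n + 1) (P.isoExt (R := ℤ) (n + 1) N).toLinearEquiv.toAddEquiv
    k hk (Ext_zsmul_eq_zero s t k hst N n)

lemma finite_Tor_succ (s : N ⟶ F) (t : F ⟶ N) (k : ℤ) (hk : k ≠ 0) (hst : s ≫ t = k • 𝟙 N)
    (n : ℕ) : Finite (((Tor (ModuleCat.{0} R) (n + 1)).obj M).obj N) := by
  have : IsNoetherianRing R := isNoetherian_of_tower ℤ inferInstance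
  obtain ⟨P, hP⟩ := N.exists_projectiveResolution_finite
  have : Module.Finite ℤ ((M.tensorComplex P.complex).X (n + 1)) := by
    have := hP (n + 1)
    have : Module.Finite R (TensorProduct R M (P.complex.X (n + 1))) := inferInstance
    have := Module.Finite.trans (R := ℤ) R (TensorProduct R M (P.complex.X (n + 1)))
    exact this.int _
  exact finite_of_addEquiv_homology _ (n + 1) (torEquiv M P (n + 1)) k hk
    (Tor_zsmul_eq_zero s t k hst M n)

end Finiteness

section BRing

variable {I : Type} {R : Subring (I → ℤ)}

lemma IsBRing.exists_support_singleton [Finite I] (hR : IsBRing R) (i : I) :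
    ∃ e ∈ R, e i ≠ 0 ∧ ∀ k, k ≠ i → e k = 0 := by
  classical
  have := Fintype.ofFinite I
  have h (k : I) : ∃ r ∈ R, r i ≠ 0 ∧ (k ≠ i → r k = 0) := by
    by_cases hk : k = i
    · exact ⟨1, one_mem R, one_ne_zero, fun h => absurd hk h⟩
    · obtain ⟨r, hr, hri, hrk⟩ := hR i k (Ne.symm hk)
      exact ⟨r, hr, hri, fun _ => hrk⟩
  choose r hr hri hrk using h
  refine ⟨∏ k, r k, prod_mem fun k _ => hr k, ?_, fun k hk => ?_⟩
  · rw [Finset.prod_apply]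
    exact Finset.prod_ne_zero_iff.2 fun k _ => hri k
  · rw [Finset.prod_apply]
    exact Finset.prod_eq_zero (Finset.mem_univ k) (hrk k hk)

/-- Evaluation at `i` as a map of modules. -/
def ZInt.eval (i : I) : ModuleCat.of R R ⟶ ZInt R i :=
  ModuleCat.ofHom (Y := ZInt R i)
    { toFun := fun r => r.1 i
      map_add' := fun _ _ => rfl
      map_smul' := fun _ _ => rfl }

lemma ZInt.eval_surjective (i : I) : Function.Surjective (ZInt.eval (R := R) i) :=
  fun n : ℤ => ⟨(n : R), by
    change ((n : R) : I → ℤ) i = n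
    simp⟩

instance (i : I) : Module.Finite R (ZInt R i) :=
  Module.Finite.of_surjective (ZInt.eval i).hom (ZInt.eval_surjective i)

lemma ZInt.exists_factorization [Finite I] (hR : IsBRing R) (i : I) :
    ∃ (k : ℤ) (_ : k ≠ 0) (s : ZInt R i ⟶ ModuleCat.of R R) (t : ModuleCat.of R R ⟶ ZInt R i),
      s ≫ t = k • 𝟙 (ZInt R i) := by
  obtain ⟨e, he, hei, hek⟩ := hR.exists_support_singleton i
  let s : ZInt R i ⟶ ModuleCat.of R R := ModuleCat.ofHom (X := ZInt R i)
    { toFun := fun n : ℤ => n • ⟨e, he⟩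
      map_add' := fun m n : ℤ => add_zsmul _ m n
      map_smul' := fun r (n : ℤ) => by
        refine Subtype.ext (funext fun k => ?_)
        change r.1 i * n * e k = r.1 k * (n * e k)
        by_cases hk : k = i
        · rw [hk, mul_assoc]
        · rw [hek k hk, mul_zero, mul_zero, mul_zero] }
  refine ⟨e i, hei, s, ZInt.eval i, ?_⟩
  ext (n : ℤ)
  exact mul_comm n (e i)

lemma ZInt.eq_zero_of_nsmul_eq_zero {p : ℕ} (hp : p ≠ 0) (i : I) (x : ZInt R i)
    (hx : p • x = 0) : x = 0 :=
  (nsmul_eq_zero_iff_right (M := ℤ) hp).1 hx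

/-- The reduction map from `ℤ_i` to `k_i`. -/
def ZInt.reduction (p : ℕ) (i : I) : ZInt R i ⟶
    (ModuleCat.restrictScalars (Ideal.Quotient.mk (Ideal.span {(p : R)}))).obj (ki R p i) :=
  ModuleCat.ofHom (X := ZInt R i)
    (Y := (ModuleCat.restrictScalars (Ideal.Quotient.mk (Ideal.span {(p : R)}))).obj (ki R p i))
    { toFun := fun n : ℤ => (n : ZMod p)
      map_add' := Int.cast_add (R := ZMod p)
      map_smul' := fun r => Int.cast_mul (α := ZMod p) (r.1 i) }

lemma ZInt.reduction_surjective (p : ℕ) (i : I) :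
    Function.Surjective (ZInt.reduction (R := R) p i) :=
  ZMod.intCast_surjective

lemma ZInt.reduction_eq_zero_iff (p : ℕ) (i : I) (x : ZInt R i) :
    ZInt.reduction p i x = 0 ↔ ∃ y, p • y = x := by
  refine (ZMod.intCast_zmod_eq_zero_iff_dvd x p).trans ?_
  exact exists_congr fun y : ℤ =>
    eq_comm.trans (iff_of_eq (congrArg (· = x) (nsmul_eq_mul p y).symm))

lemma Subring.finite_int_pi [Finite I] (R : Subring (I → ℤ)) : Module.Finite ℤ R :=
  Module.Finite.of_injective R.subtype.toAddMonoidHom.toIntLinearMap Subtype.val_injective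

lemma Subring.eq_zero_of_nsmul_eq_zero {p : ℕ} (hp : p ≠ 0) (r : R) (hr : p • r = 0) : r = 0 :=
  Subtype.ext (funext fun k =>
    (nsmul_eq_zero_iff_right (M := ℤ) hp).1 (congrFun (congrArg Subtype.val hr) k))

end BRing

/-- Let `R ⊆ Gh(I)` be a B-ring, `p` a prime, `k = 𝔽_p`, `R̄ = R/pR`, `i, j ∈ I`.  For `l ≥ 1`
let `a_l = dim_k {x ∈ Ext^l_R(ℤ_i, ℤ_j) | p x = 0}`, `b_l = dim_k Ext^l_{R̄}(k_i, k_j)`,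
`z_l = dim_k {x ∈ Tor^R_l(ℤ_i, ℤ_j) | p x = 0}`, `y_l = dim_k Tor^{R̄}_l(k_i, k_j)` (for the
`k`-vector spaces `Ext^l_{R̄}(k_i, k_j)`, `Tor^{R̄}_l(k_i, k_j)` this dimension agrees with
their `k`-dimension).  Then `a_{l+1} = b_l - a_l` and `z_l = y_{l+1} - z_{l+1}` for `l ≥ 1`. -/
theorem stmt_7 (I : Type) [Fintype I] (R : Subring (I → ℤ)) (hR : IsBRing R)
    (p : ℕ) (hp : p.Prime) (i j : I)
    (a b z y : ℕ → ℕ)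
    (ha : ∀ l, a l = pDim p (((Ext ℤ (ModuleCat R) l).obj (Opposite.op (ZInt R i))).obj (ZInt R j)))
    (hb : ∀ l, b l = pDim p (((Ext ℤ (ModuleCat (R ⧸ Ideal.span {(p : R)})) l).obj
      (Opposite.op (ki R p i))).obj (ki R p j)))
    (hz : ∀ l, z l = pDim p (((Tor (ModuleCat R) l).obj (ZInt R i)).obj (ZInt R j)))
    (hy : ∀ l, y l = pDim p (((Tor (ModuleCat (R ⧸ Ideal.span {(p : R)})) l).obj
      (ki R p i)).obj (ki R p j)))
    (l : ℕ) (hl : 1 ≤ l) :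
    ((a (l + 1) : ℤ) = b l - a l) ∧ ((z l : ℤ) = y (l + 1) - z (l + 1)) := by
  obtain ⟨n, rfl⟩ := Nat.exists_eq_add_of_le' hl
  have hp' : p ≠ 0 := hp.ne_zero
  have hφ := Ideal.Quotient.mk_surjective (I := Ideal.span {(p : R)})
  have hker (r : R) : Ideal.Quotient.mk (Ideal.span {(p : R)}) r = 0 ↔ ∃ s, p * s = r := by
    rw [Ideal.Quotient.eq_zero_iff_mem, Ideal.mem_span_singleton]
    exact exists_congr fun _ => eq_comm
  have : Module.Finite ℤ R := R.finite_int_pi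
  obtain ⟨k, hk, s, t, hst⟩ := ZInt.exists_factorization hR i
  obtain ⟨k', hk', s', t', hst'⟩ := ZInt.exists_factorization hR j
  have : Projective (ModuleCat.of R R) :=
    ModuleCat.projective_of_free (Module.Basis.singleton Unit R)
  have hE (m : ℕ) := finite_Ext_succ (N := ZInt R j) s t k hk hst m
  have hT (m : ℕ) := finite_Tor_succ (M := ZInt R i) s' t' k' hk' hst' m
  have h₁ := pDim_Ext_reduction hp hφ hker (Subring.eq_zero_of_nsmul_eq_zero hp')
    (ZInt.eq_zero_of_nsmul_eq_zero hp' i) (ZInt.eq_zero_of_nsmul_eq_zero hp' j)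
    (ZInt.reduction p i) (ZInt.reduction_surjective p i) (ZInt.reduction_eq_zero_iff p i)
    (ZInt.reduction p j) (ZInt.reduction_surjective p j) (ZInt.reduction_eq_zero_iff p j) (n + 1)
  have h₂ := pDim_Tor_reduction hp hφ hker (Subring.eq_zero_of_nsmul_eq_zero hp')
    (ZInt.eq_zero_of_nsmul_eq_zero hp' i) (ZInt.eq_zero_of_nsmul_eq_zero hp' j)
    (ZInt.reduction p i) (ZInt.reduction_surjective p i) (ZInt.reduction_eq_zero_iff p i)
    (ZInt.reduction p j) (ZInt.reduction_surjective p j) (ZInt.reduction_eq_zero_iff p j) (n + 1)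
  rw [← ha, ← ha, ← hb] at h₁
  rw [← hz, ← hz, ← hy] at h₂
  omega
end
end

section
/- Let R ⊆ Gh(I) be a B-ring, p a prime, and suppose distinct i, j ∈ I are such that {i, j} is a full equivalence class of the relation ∼_p on I. Let a_l and a'_l denote the p-ranks of Ext^l_R(ℤ_i, ℤ_i) and Ext^l_R(ℤ_i, ℤ_j) respectively (the p-rank of a finite abelian group A being dim_{𝔽_p}{x ∈ A : px = 0}). Then for all l ≥ 1: a_l = 0 if l is odd and a_l = 1 if l is even, while a'_l = 1 if l is odd and a'_l = 0 if l is even. -/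
set_option synthInstance.maxHeartbeats 400000
set_option maxHeartbeats 1000000

noncomputable section

open CategoryTheory

/-- The relation `∼_p` on `I`: `i ∼_p j` iff `r i ≡ r j (mod p)` for all `r ∈ R`
(equivalently, `i = j` or `p ∣ d(i, j)`). -/
def SimP {I : Type*} (R : Subring (I → ℤ)) (p : ℕ) (i j : I) : Prop :=
  ∀ r ∈ R, (p : ℤ) ∣ (r i - r j)

/-- The `p`-rank of an abelian group `A`: the dimension over `𝔽_p` of `{x ∈ A | p • x = 0}`. -/
def pRank (p : ℕ) (A : Type*) [AddCommGroup A] : ℕ :=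
  letI := AddSubgroup.torsionBy.zmodModule (A := A) (n := p)
  Module.finrank (ZMod p) (AddSubgroup.torsionBy A p)

lemma IsCoprime.eq_zero_of_smul {m n : ℤ} (h : IsCoprime m n) {A : Type*} [AddCommGroup A]
    {a : A} (hm : m • a = 0) (hn : n • a = 0) : a = 0 := by
  obtain ⟨u, v, huv⟩ := h
  rw [← one_smul ℤ a, ← huv, add_smul, mul_smul, mul_smul, hm, hn, smul_zero, smul_zero, add_zero]

lemma AddSubgroup.mem_torsionBy_iff {A : Type*} [AddCommGroup A] {n : ℤ} {a : A} :
    a ∈ AddSubgroup.torsionBy A n ↔ n • a = 0 := Iff.rfl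

lemma pRank_eq_of_comp_eq_smul {p : ℕ} {A B : Type*} [AddCommGroup A] [AddCommGroup B]
    (f : A →+ B) (g : B →+ A) {m n : ℤ}
    (hm : IsCoprime m (p : ℤ)) (hn : IsCoprime n (p : ℤ))
    (hgf : ∀ a, g (f a) = m • a) (hfg : ∀ b, f (g b) = n • b) : pRank p A = pRank p B := by
  let := AddSubgroup.torsionBy.zmodModule (A := A) (n := p)
  let := AddSubgroup.torsionBy.zmodModule (A := B) (n := p)
  let F : AddSubgroup.torsionBy A (p : ℤ) →+ AddSubgroup.torsionBy B (p : ℤ) :=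
    (f.comp (AddSubgroup.subtype _)).codRestrict _ fun a => by
      change (p : ℤ) • f a = 0
      rw [← map_zsmul, AddSubgroup.mem_torsionBy_iff.1 a.2, map_zero]
  refine (LinearEquiv.ofBijective (F.toZModLinearMap p) ⟨?_, ?_⟩).finrank_eq
  · rw [injective_iff_map_eq_zero]
    intro a ha
    refine Subtype.ext (hm.eq_zero_of_smul ?_ a.2)
    rw [← hgf]
    exact (congrArg g (congrArg Subtype.val ha)).trans (map_zero g)
  · intro b
    obtain ⟨u, v, huv⟩ := hn
    have hb : (p : ℤ) • (b : B) = 0 := b.2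
    refine ⟨⟨g (u • (b : B)), ?_⟩, Subtype.ext ?_⟩
    · rw [AddSubgroup.mem_torsionBy_iff, ← map_zsmul, smul_comm, hb, smul_zero, map_zero]
    · change f (g (u • (b : B))) = b
      rw [hfg, smul_smul, mul_comm, ← add_zero ((u * n) • (b : B)), ← smul_zero v, ← hb, smul_smul,
        ← add_smul, huv, one_smul]

lemma pRank_congr {p : ℕ} {A B : Type*} [AddCommGroup A] [AddCommGroup B] (e : A ≃+ B) :
    pRank p A = pRank p B :=
  pRank_eq_of_comp_eq_smul (e : A →+ B) (e.symm : B →+ A) (m := 1) (n := 1)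
    isCoprime_one_left isCoprime_one_left (by simp) (by simp)

lemma pRank_eq_zero {p : ℕ} {A : Type*} [AddCommGroup A] (hp : p.Prime)
    (h : ∀ a : A, (p : ℤ) • a = 0 → a = 0) : pRank p A = 0 := by
  have := Fact.mk hp
  let := AddSubgroup.torsionBy.zmodModule (A := A) (n := p)
  have : Subsingleton (AddSubgroup.torsionBy A (p : ℤ)) :=
    subsingleton_of_forall_eq 0 fun a => Subtype.ext (h a a.2)
  exact Module.finrank_zero_of_subsingleton

lemma pRank_eq_one {p : ℕ} {d : ℤ} {A : Type*} [AddCommGroup A] (hp : p.Prime) (hd : d ≠ 0)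
    (hpd : (p : ℤ) ∣ d) (φ : ℤ →+ A) (hφ : Function.Surjective φ)
    (hker : ∀ c, φ c = 0 ↔ d ∣ c) : pRank p A = 1 := by
  let := AddSubgroup.torsionBy.zmodModule (A := A) (n := p)
  have := Fact.mk hp
  obtain ⟨e, rfl⟩ := hpd
  have hp0 : (p : ℤ) ≠ 0 := by exact_mod_cast hp.ne_zero
  have he : e ≠ 0 := right_ne_zero_of_mul hd
  have mem : ∀ c : ℤ, φ c ∈ AddSubgroup.torsionBy A (p : ℤ) ↔ e ∣ c := fun c => by
    rw [AddSubgroup.mem_torsionBy_iff, ← map_zsmul, hker, smul_eq_mul, mul_dvd_mul_iff_left hp0]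
  let v : AddSubgroup.torsionBy A (p : ℤ) := ⟨φ e, (mem e).2 dvd_rfl⟩
  refine (finrank_eq_one_iff_of_nonzero' v ?_).2 ?_
  · intro hv
    have h1 : (p : ℤ) * e ∣ 1 * e := by
      rw [one_mul]; exact (hker e).1 (congrArg Subtype.val hv)
    rw [mul_dvd_mul_iff_right he] at h1
    exact hp.one_lt.ne' (by exact_mod_cast Int.eq_one_of_dvd_one (by positivity) h1)
  · rintro ⟨w, hw⟩
    obtain ⟨c, rfl⟩ := hφ w
    obtain ⟨k, rfl⟩ := (mem c).1 hw
    refine ⟨(k : ZMod p), ?_⟩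
    rw [Int.cast_smul_eq_zsmul]
    refine Subtype.ext ?_
    change k • φ e = _
    rw [← map_zsmul, smul_eq_mul, mul_comm]

lemma exists_ker_surjective_homology {A : Type*} [Ring A] (S : ShortComplex (ModuleCat A)) :
    ∃ π : LinearMap.ker S.g.hom →+ S.homology, Function.Surjective π ∧
      ∀ f, π f = 0 ↔ ∃ g, S.f g = f := by
  let e := S.moduleCatHomologyIso.toLinearEquiv.symm.toAddEquiv
  let q : LinearMap.ker S.g.hom →+ S.moduleCatLeftHomologyData.H :=
    (Submodule.mkQ S.moduleCatToCycles.range).toAddMonoidHom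
  refine ⟨e.toAddMonoidHom.comp q, e.surjective.comp (Submodule.mkQ_surjective _), fun f => ?_⟩
  refine (map_eq_zero_iff e e.injective).trans ((Submodule.Quotient.mk_eq_zero _).trans ?_)
  exact ⟨fun ⟨g, hg⟩ => ⟨g, congrArg Subtype.val hg⟩, fun ⟨g, hg⟩ => ⟨g, Subtype.ext hg⟩⟩

lemma nonempty_ext_addEquiv {C : Type*} [Category* C] [Abelian C] [Linear ℤ C]
    [EnoughProjectives C] [HasExt C] (X Y : C) (n : ℕ) :
    Nonempty (((Ext ℤ C (n + 1)).obj (Opposite.op X)).obj Y ≃+ Abelian.Ext X Y (n + 1)) := by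
  let P := ProjectiveResolution.of X
  let K := P.complex.linearYonedaObj ℤ Y
  let S := K.sc' n (n + 1) (n + 2)
  let e : ((Ext ℤ C (n + 1)).obj (Opposite.op X)).obj Y ≅ S.homology :=
    P.isoExt (n + 1) Y ≪≫
      ShortComplex.homologyMapIso (K.isoSc' n (n + 1) (n + 2) (by simp) (by simp))
  have hker : ∀ f : P.complex.X (n + 1) ⟶ Y,
      f ∈ LinearMap.ker S.g.hom ↔ P.complex.d (n + 2) (n + 1) ≫ f = 0 :=
    fun _ => Iff.rfl
  let ψ : LinearMap.ker S.g.hom →+ Abelian.Ext X Y (n + 1) :=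
    { toFun f := P.extMk f.1 (n + 2) rfl ((hker _).1 f.2)
      map_zero' := P.extMk_zero _ _
      map_add' f g := (P.add_extMk f.1 g.1 _ _ ((hker _).1 f.2) ((hker _).1 g.2)).symm }
  have hψ : Function.Surjective ψ := fun α => by
    obtain ⟨f, hf, rfl⟩ := P.extMk_surjective α (n + 2) rfl
    exact ⟨⟨f, hf⟩, rfl⟩
  obtain ⟨π, hπ, hπ0⟩ := exists_ker_surjective_homology S
  have hπψ : π.ker = ψ.ker := by
    ext f
    exact (hπ0 f).trans (P.extMk_eq_zero_iff f.1 (n + 2) rfl ((hker _).1 f.2) n rfl).symm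
  exact ⟨e.toLinearEquiv.toAddEquiv.trans
    ((QuotientAddGroup.quotientKerEquivOfSurjective π hπ).symm.trans
      ((QuotientAddGroup.quotientAddEquivOfEq hπψ).trans
        (QuotientAddGroup.quotientKerEquivOfSurjective ψ hψ)))⟩

lemma nonempty_ext_X₁_addEquiv_ext_X₃ {C : Type*} [Category* C] [Abelian C] [HasExt C]
    {S : ShortComplex C} (hS : S.ShortExact) [Projective S.X₂] (Y : C) (n : ℕ) :
    Nonempty (Abelian.Ext S.X₁ Y (n + 1) ≃+ Abelian.Ext S.X₃ Y (n + 2)) := by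
  refine ⟨AddEquiv.ofBijective (hS.extClass.precomp Y (add_comm 1 (n + 1))) ⟨?_, fun x => ?_⟩⟩
  · rw [injective_iff_map_eq_zero]
    intro x hx
    obtain ⟨y, rfl⟩ := Abelian.Ext.contravariant_sequence_exact₁ hS Y x (add_comm 1 (n + 1)) hx
    rw [Abelian.Ext.eq_zero_of_projective y, Abelian.Ext.comp_zero]
  · exact Abelian.Ext.contravariant_sequence_exact₃ hS Y x
      (Abelian.Ext.eq_zero_of_projective _) (add_comm 1 (n + 1))

lemma pRank_ext_eq_of_comp_eq_smul {A C : Type*} [CommRing A] [Category* C] [Abelian C]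
    [Linear A C] [HasExt C] {p : ℕ} {X X' Y : C} (φ : X ⟶ X') (ψ : X' ⟶ X) (s : A) {m n : ℤ}
    (hm : IsCoprime m (p : ℤ)) (hn : IsCoprime n (p : ℤ)) (hφψ : φ ≫ ψ = m • 𝟙 X)
    (hψφ : ψ ≫ φ = s • 𝟙 X') (hY : s • 𝟙 Y = n • 𝟙 Y) (l : ℕ) :
    pRank p (Abelian.Ext X' Y l) = pRank p (Abelian.Ext X Y l) := by
  have hcomp : ∀ {U V : C} (f : U ⟶ V) (g : V ⟶ U) (x : Abelian.Ext U Y l),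
      (Abelian.Ext.mk₀ f).comp ((Abelian.Ext.mk₀ g).comp x (zero_add l)) (zero_add l) =
        (Abelian.Ext.mk₀ (f ≫ g)).comp x (zero_add l) := by
    intro U V f g x
    simp
  have hz : ∀ {U V : C} (f : U ⟶ V) (k : ℤ), Abelian.Ext.mk₀ (k • f) = k • Abelian.Ext.mk₀ f :=
    fun f k => map_zsmul (Abelian.Ext.addEquiv₀ (X := _) (Y := _)).symm k f
  refine pRank_eq_of_comp_eq_smul ((Abelian.Ext.mk₀ φ).precomp Y (zero_add l))
    ((Abelian.Ext.mk₀ ψ).precomp Y (zero_add l)) hn hm (fun x => ?_) (fun x => ?_)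
  · refine (hcomp ψ φ x).trans ?_
    rw [hψφ, Abelian.Ext.mk₀_smul, Abelian.Ext.smul_comp, Abelian.Ext.mk₀_id_comp,
      Abelian.Ext.smul_eq_comp_mk₀, hY, hz]
    refine (map_zsmul (x.precomp Y (add_zero l)) n _).trans (congrArg (n • ·) ?_)
    exact Abelian.Ext.comp_mk₀_id x
  · refine (hcomp φ ψ x).trans ?_
    rw [hφψ, hz]
    refine (map_zsmul (x.postcomp X (zero_add l)) m _).trans (congrArg (m • ·) ?_)
    exact Abelian.Ext.mk₀_id_comp x

/-- The additive identification of `ℤ_i` with `ℤ`. -/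
def zIntEquiv {I : Type} (R : Subring (I → ℤ)) (i : I) : ZInt R i ≃+ ℤ := AddEquiv.refl ℤ

lemma zIntEquiv_smul {I : Type} {R : Subring (I → ℤ)} {i : I} (r : R) (x : ZInt R i) :
    zIntEquiv R i (r • x) = (r : I → ℤ) i * zIntEquiv R i x := rfl

/-- The evaluation `R → ℤ_i`, `r ↦ r i`, as an `R`-linear map. -/
def evalLinearMap {I : Type} (R : Subring (I → ℤ)) (i : I) : R →ₗ[R] ZInt R i where
  toFun r := (zIntEquiv R i).symm ((r : I → ℤ) i)
  map_add' r s := by simp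
  map_smul' r s := rfl

lemma zIntEquiv_evalLinearMap {I : Type} {R : Subring (I → ℤ)} {i : I} (r : R) :
    zIntEquiv R i (evalLinearMap R i r) = (r : I → ℤ) i := rfl

lemma mem_ker_evalLinearMap {I : Type} {R : Subring (I → ℤ)} {i : I} (r : R) :
    r ∈ LinearMap.ker (evalLinearMap R i) ↔ (r : I → ℤ) i = 0 := Iff.rfl

lemma evalLinearMap_surjective {I : Type} (R : Subring (I → ℤ)) (i : I) :
    Function.Surjective (evalLinearMap R i) := fun x =>
  ⟨(zIntEquiv R i x : R), by
    apply (zIntEquiv R i).injective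
    simp [zIntEquiv_evalLinearMap]⟩

lemma smul_id_ZInt {I : Type} {R : Subring (I → ℤ)} (s : R) (i : I) :
    s • 𝟙 (ZInt R i) = ((s : I → ℤ) i) • 𝟙 (ZInt R i) := by
  ext x
  apply (zIntEquiv R i).injective
  rw [ModuleCat.hom_smul, ModuleCat.hom_zsmul]
  simp [zIntEquiv_smul]

lemma exists_generator_sub {I : Type} {R : Subring (I → ℤ)} (hR : IsBRing R)
    {i j : I} (hij : i ≠ j) :
    ∃ t : R, (t : I → ℤ) i = 0 ∧ (t : I → ℤ) j ≠ 0 ∧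
      ∀ r : R, (r : I → ℤ) i = 0 → (t : I → ℤ) j ∣ (r : I → ℤ) j := by
  let D : AddSubgroup ℤ := (LinearMap.ker (evalLinearMap R i)).toAddSubgroup.map
    ((Pi.evalAddMonoidHom (fun _ => ℤ) j).comp R.subtype.toAddMonoidHom)
  obtain ⟨d, hd⟩ := Int.subgroup_cyclic D
  have hdD : d ∈ D := hd ▸ AddSubgroup.subset_closure rfl
  obtain ⟨t, ht, rfl⟩ := hdD
  have ht' : ∀ r : R, (r : I → ℤ) i = 0 → (t : I → ℤ) j ∣ (r : I → ℤ) j := by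
    intro r hr
    have : (r : I → ℤ) j ∈ D := ⟨r, hr, rfl⟩
    rw [hd, AddSubgroup.mem_closure_singleton] at this
    obtain ⟨k, hk⟩ := this
    exact ⟨k, by rw [← hk, smul_eq_mul, mul_comm]; rfl⟩
  refine ⟨t, ht, fun h0 => ?_, ht'⟩
  obtain ⟨r, hr, hrj, hri⟩ := hR j i hij.symm
  have := ht' ⟨r, hr⟩ hri
  rw [h0, zero_dvd_iff] at this
  exact hrj this

lemma exists_eq_zero_off_class {I : Type} [Fintype I] {R : Subring (I → ℤ)}
    {p : ℕ} (hp : p.Prime) {i j : I} (hsim : SimP R p i j)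
    (hclass : ∀ m : I, SimP R p i m → m = i ∨ m = j) :
    ∃ s : R, (∀ m, m ≠ i → m ≠ j → (s : I → ℤ) m = 0) ∧
      IsCoprime ((s : I → ℤ) i) (p : ℤ) ∧ IsCoprime ((s : I → ℤ) j) (p : ℤ) := by
  classical
  have hpp : Prime (p : ℤ) := Nat.prime_iff_prime_int.1 hp
  have h1 : ∀ m : I, ∃ s : R, (m ≠ i → m ≠ j → (s : I → ℤ) m = 0) ∧ ¬ (p : ℤ) ∣ (s : I → ℤ) i := by
    intro m
    by_cases hm : SimP R p i m
    · refine ⟨1, fun h h' => ?_, hpp.not_dvd_one⟩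
      rcases hclass m hm with h'' | h'' <;> contradiction
    · simp only [SimP, not_forall] at hm
      obtain ⟨r, hr, hrm⟩ := hm
      refine ⟨⟨r, hr⟩ - ((r m : ℤ) : R), fun _ _ => ?_, ?_⟩
      · simp
      · simpa using hrm
  choose s hs hsi using h1
  have hco : ¬ (p : ℤ) ∣ ((∏ m, s m : R) : I → ℤ) i := by
    simpa [hpp.dvd_finsetProd_iff] using hsi
  refine ⟨∏ m, s m, fun m hi hj => ?_, ?_, ?_⟩
  · simpa [Finset.prod_eq_zero_iff] using ⟨m, hs m hi hj⟩
  · exact ((hpp.coprime_iff_not_dvd).2 hco).symm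
  · refine ((hpp.coprime_iff_not_dvd).2 fun h => hco ?_).symm
    exact (dvd_iff_dvd_of_dvd_sub (hsim _ (∏ m, s m : R).2)).2 h

lemma exists_hom_X₁_surjective_ext_one {C : Type*} [Category* C] [Abelian C] [HasExt C]
    {S : ShortComplex C} (hS : S.ShortExact) [Projective S.X₂] (Y : C) :
    ∃ δ : (S.X₁ ⟶ Y) →+ Abelian.Ext S.X₃ Y 1, Function.Surjective δ ∧
      ∀ h, δ h = 0 ↔ ∃ y, S.f ≫ y = h := by
  refine ⟨(hS.extClass.precomp Y (add_zero 1)).comp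
    (Abelian.Ext.addEquiv₀ (X := S.X₁) (Y := Y)).symm.toAddMonoidHom, fun x => ?_, fun h => ?_⟩
  · obtain ⟨x₁, hx₁⟩ := Abelian.Ext.contravariant_sequence_exact₃ hS Y x
      (Abelian.Ext.eq_zero_of_projective _) (add_zero 1)
    exact ⟨Abelian.Ext.addEquiv₀ x₁, by simpa using hx₁⟩
  · change hS.extClass.comp (Abelian.Ext.mk₀ h) (add_zero 1) = 0 ↔ _
    constructor
    · intro h0
      obtain ⟨y, hy⟩ := Abelian.Ext.contravariant_sequence_exact₁ hS Y _ (add_zero 1) h0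
      obtain ⟨y, rfl⟩ := Abelian.Ext.addEquiv₀.symm.surjective y
      exact ⟨y, (Abelian.Ext.mk₀_bijective _ _).1 (by simpa using hy)⟩
    · rintro ⟨y, rfl⟩
      rw [← Abelian.Ext.mk₀_comp_mk₀, ← Abelian.Ext.comp_assoc_of_second_deg_zero,
        hS.extClass_comp, Abelian.Ext.zero_comp]

/-- The short exact sequence `0 → K → R → ℤ_i → 0`, where `K` consists of the `r ∈ R` with
`r i = 0`. -/
abbrev evalShortComplex {I : Type} (R : Subring (I → ℤ)) (i : I) : ShortComplex (ModuleCat R) :=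
  (evalLinearMap R i).shortComplexKer

lemma evalShortComplex_shortExact {I : Type} (R : Subring (I → ℤ)) (i : I) :
    (evalShortComplex R i).ShortExact :=
  LinearMap.shortExact_shortComplexKer (evalLinearMap_surjective R i)

instance {I : Type} (R : Subring (I → ℤ)) (i : I) : Projective (evalShortComplex R i).X₂ :=
  ModuleCat.projective_of_free (Module.Basis.singleton Unit R)

/-- If `d` divides `r j` for all `r ∈ R` with `r i = 0`, the map `K → ℤ_j`, `r ↦ r j / d`,
on the kernel `K` of `R → ℤ_i`. -/
def kerDiv {I : Type} {R : Subring (I → ℤ)} {i j : I} (d : ℤ)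
    (hd : ∀ r : R, (r : I → ℤ) i = 0 → d ∣ (r : I → ℤ) j) :
    (evalShortComplex R i).X₁ ⟶ ZInt R j :=
  ModuleCat.ofHom (Y := ZInt R j)
    { toFun := fun r => (zIntEquiv R j).symm ((r.1 : I → ℤ) j / d)
      map_add' := fun r s => (zIntEquiv R j).injective <| by
        simpa using Int.add_ediv_of_dvd_left (hd _ r.2)
      map_smul' := fun a r => (zIntEquiv R j).injective <| by
        rw [AddEquiv.apply_symm_apply]
        exact Int.mul_ediv_assoc _ (hd _ r.2) }

/-- If `u` is supported at `j`, the map `ℤ_j → K`, `x ↦ x • u`, to the kernel `K` of `R → ℤ_i`. -/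
def zIntToKer {I : Type} {R : Subring (I → ℤ)} {i j : I} (u : R)
    (hu : ∀ m, m ≠ j → (u : I → ℤ) m = 0) (hij : i ≠ j) :
    ZInt R j ⟶ (evalShortComplex R i).X₁ :=
  ModuleCat.ofHom (X := ZInt R j)
    { toFun := fun x => ⟨zIntEquiv R j x • u, by
        rw [mem_ker_evalLinearMap]
        simp [hu i hij]⟩
      map_add' := fun x y => Subtype.ext (by simp [add_mul])
      map_smul' := fun r x => by
        refine Subtype.ext (Subtype.ext (funext fun m => ?_))
        by_cases hm : m = j
        · subst hm
          have h : ∀ c : ℤ, ((c • u : R) : I → ℤ) m = c * (u : I → ℤ) m := fun c => by simp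
          exact (h _).trans ((mul_assoc _ _ _).trans (congrArg ((r : I → ℤ) m * ·) (h _).symm))
        · simp [hu m hm] }

lemma zIntToKer_kerDiv {I : Type} {R : Subring (I → ℤ)} {i j : I} {d k : ℤ} (hd0 : d ≠ 0)
    (hd : ∀ r : R, (r : I → ℤ) i = 0 → d ∣ (r : I → ℤ) j) (u : R)
    (hu : ∀ m, m ≠ j → (u : I → ℤ) m = 0) (hij : i ≠ j) (huj : (u : I → ℤ) j = k * d) :
    zIntToKer u hu hij ≫ kerDiv d hd = k • 𝟙 (ZInt R j) := by
  ext x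
  apply (zIntEquiv R j).injective
  have : (zIntEquiv R j x * (u : I → ℤ) j) / d = k * zIntEquiv R j x := by
    rw [huj, ← mul_assoc, Int.mul_ediv_cancel _ hd0, mul_comm]
  have h : ((zIntEquiv R j x • u : R) : I → ℤ) j = zIntEquiv R j x * (u : I → ℤ) j := by simp
  rw [ModuleCat.hom_zsmul]
  refine (congrArg (· / d) h).trans (this.trans ?_)
  simp

lemma kerDiv_zIntToKer {I : Type} {R : Subring (I → ℤ)} {i j : I} {d : ℤ}
    (hd : ∀ r : R, (r : I → ℤ) i = 0 → d ∣ (r : I → ℤ) j) (u s : R)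
    (hu : ∀ m, m ≠ j → (u : I → ℤ) m = 0) (hij : i ≠ j)
    (hs : ∀ m, m ≠ i → m ≠ j → (s : I → ℤ) m = 0) (huj : (u : I → ℤ) j = (s : I → ℤ) j * d) :
    kerDiv d hd ≫ zIntToKer u hu hij = s • 𝟙 (evalShortComplex R i).X₁ := by
  ext r m
  change ((((r.1 : I → ℤ) j / d) • u : R) : I → ℤ) m = (s : I → ℤ) m * (r.1 : I → ℤ) m
  have hri : (r.1 : I → ℤ) i = 0 := r.2
  have hz : ((((r.1 : I → ℤ) j / d) • u : R) : I → ℤ) m =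
      ((r.1 : I → ℤ) j / d) * (u : I → ℤ) m := by simp
  rw [hz]
  by_cases hm : m = j
  · subst hm
    rw [huj, mul_left_comm, Int.ediv_mul_cancel (hd r.1 hri)]
  · rw [hu m hm, mul_zero]
    by_cases hmi : m = i
    · rw [hmi, hri, mul_zero]
    · rw [hs m hmi hm, zero_mul]

lemma hom_ker_to_zInt_apply {I : Type} {R : Subring (I → ℤ)} {i j : I} (t : R)
    (ht : (t : I → ℤ) i = 0) (h : (evalShortComplex R i).X₁ ⟶ ZInt R j)
    (r : LinearMap.ker (evalLinearMap R i)) :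
    (t : I → ℤ) j * zIntEquiv R j (h.hom r) = (r.1 : I → ℤ) j * zIntEquiv R j (h.hom ⟨t, ht⟩) := by
  have hr : t • r = r.1 • (⟨t, ht⟩ : LinearMap.ker (evalLinearMap R i)) :=
    Subtype.ext (mul_comm t r.1)
  have := congrArg (fun x => zIntEquiv R j (h.hom x)) hr
  simp only [map_smul] at this
  exact this

lemma zIntEquiv_hom_apply {I : Type} {R : Subring (I → ℤ)} {i j : I}
    (y : (evalShortComplex R i).X₂ ⟶ ZInt R j) (r : R) :
    zIntEquiv R j (y.hom r) = (r : I → ℤ) j * zIntEquiv R j (y.hom (1 : R)) := by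
  have h := congrArg (fun x => zIntEquiv R j (y.hom x)) (mul_one r)
  exact h.symm.trans (congrArg (zIntEquiv R j) (y.hom.map_smul r (1 : R)))

lemma pRank_ext_one_self {I : Type} (R : Subring (I → ℤ)) {p : ℕ} (hp : p.Prime) (i : I) :
    pRank p (Abelian.Ext (ZInt R i) (ZInt R i) 1) = 0 := by
  obtain ⟨δ, hδ, hδ0⟩ := exists_hom_X₁_surjective_ext_one (evalShortComplex_shortExact R i)
    (ZInt R i)
  refine pRank_eq_zero hp fun a ha => ?_
  obtain ⟨h, rfl⟩ := hδ a
  rw [← map_zsmul, hδ0] at ha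
  obtain ⟨y, hy⟩ := ha
  have h0 : h = 0 := by
    ext r
    apply (zIntEquiv R i).injective
    have h1 := congrArg (fun f => zIntEquiv R i (f.hom r)) hy
    have h2 : zIntEquiv R i (((p : ℤ) • h).hom r) = p * zIntEquiv R i (h.hom r) := by
      rw [ModuleCat.hom_zsmul, LinearMap.smul_apply, map_zsmul, smul_eq_mul]
    have h3 : (p : ℤ) * zIntEquiv R i (h.hom r) = 0 := by
      rw [← h2, ← h1]
      refine (zIntEquiv_hom_apply y r.1).trans ?_
      rw [show (r.1 : I → ℤ) i = 0 from r.2, zero_mul]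
    exact (mul_eq_zero.1 h3).resolve_left (by exact_mod_cast hp.ne_zero)
  rw [h0, map_zero]

lemma pRank_ext_one_of_ne {I : Type} {R : Subring (I → ℤ)} (hR : IsBRing R) {p : ℕ}
    (hp : p.Prime) {i j : I} (hij : i ≠ j) (hsim : SimP R p i j) :
    pRank p (Abelian.Ext (ZInt R i) (ZInt R j) 1) = 1 := by
  obtain ⟨t, hti, htj, hd⟩ := exists_generator_sub hR hij
  obtain ⟨δ, hδ, hδ0⟩ := exists_hom_X₁_surjective_ext_one (evalShortComplex_shortExact R i)
    (ZInt R j)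
  have hpt : (p : ℤ) ∣ (t : I → ℤ) j := by simpa [hti] using hsim t t.2
  let T : LinearMap.ker (evalLinearMap R i) := ⟨t, hti⟩
  let ev : ((evalShortComplex R i).X₁ ⟶ ZInt R j) →+ ℤ :=
    { toFun h := zIntEquiv R j (h.hom T)
      map_zero' := by simp
      map_add' f g := by simp }
  have hev : Function.Injective ev := by
    rw [injective_iff_map_eq_zero]
    intro h hh
    ext r
    apply (zIntEquiv R j).injective
    have h1 := hom_ker_to_zInt_apply t hti h r
    have h2 : zIntEquiv R j (h.hom T) = 0 := hh
    rw [h2, mul_zero] at h1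
    exact (mul_eq_zero.1 h1).resolve_left htj
  have hev1 : ev (kerDiv _ hd) = 1 := Int.ediv_self htj
  have hevc : ∀ c : ℤ, ev (zmultiplesHom _ (kerDiv _ hd) c) = c := fun c => by
    rw [zmultiplesHom_apply, map_zsmul, hev1, smul_eq_mul, mul_one]
  have hall : ∀ h, h = ev h • kerDiv _ hd := fun h => hev (hevc (ev h)).symm
  refine pRank_eq_one hp htj hpt (δ.comp (zmultiplesHom _ (kerDiv _ hd))) (fun a => ?_)
    fun c => ?_
  · obtain ⟨h, rfl⟩ := hδ a
    exact ⟨ev h, congrArg δ (hall h).symm⟩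
  · refine (hδ0 _).trans ⟨?_, ?_⟩
    · rintro ⟨y, hy⟩
      have h1 := congrArg ev hy
      rw [hevc] at h1
      exact ⟨_, h1.symm.trans (zIntEquiv_hom_apply y t)⟩
    · rintro ⟨k, rfl⟩
      refine ⟨k • ModuleCat.ofHom (Y := ZInt R j) (evalLinearMap R j), hev ?_⟩
      rw [hevc, Preadditive.comp_zsmul, map_zsmul, smul_eq_mul, mul_comm]
      rfl

lemma pRank_ext_succ {I : Type} [Fintype I] {R : Subring (I → ℤ)} (hR : IsBRing R)
    {p : ℕ} (hp : p.Prime) {i j : I} (hij : i ≠ j) (hsim : SimP R p i j)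
    (hclass : ∀ m : I, SimP R p i m → m = i ∨ m = j) {k : I} (hk : k = i ∨ k = j) (l : ℕ) :
    pRank p (Abelian.Ext (ZInt R i) (ZInt R k) (l + 2)) =
      pRank p (Abelian.Ext (ZInt R j) (ZInt R k) (l + 1)) := by
  obtain ⟨t, hti, htj, hd⟩ := exists_generator_sub hR hij
  obtain ⟨s, hs, hsi, hsj⟩ := exists_eq_zero_off_class hp hsim hclass
  obtain ⟨e⟩ := nonempty_ext_X₁_addEquiv_ext_X₃ (evalShortComplex_shortExact R i) (ZInt R k) l
  have hu : ∀ m, m ≠ j → ((s * t : R) : I → ℤ) m = 0 := by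
    intro m hm
    by_cases hmi : m = i
    · simp [hmi, hti]
    · simp [hs m hmi hm]
  have hsk : IsCoprime ((s : I → ℤ) k) (p : ℤ) := by
    rcases hk with rfl | rfl <;> assumption
  refine (pRank_congr e).symm.trans ?_
  exact pRank_ext_eq_of_comp_eq_smul _ _ s hsj hsk
    (zIntToKer_kerDiv htj hd (s * t) hu hij rfl) (kerDiv_zIntToKer hd (s * t) s hu hij hs rfl)
    (smul_id_ZInt s k) _

lemma pRank_ext {I : Type} [Fintype I] {R : Subring (I → ℤ)} (hR : IsBRing R)
    {p : ℕ} (hp : p.Prime) {i j : I} (hij : i ≠ j) (hsim : SimP R p i j)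
    (hclass : ∀ m : I, SimP R p i m → m = i ∨ m = j) (l : ℕ) :
    pRank p (Abelian.Ext (ZInt R i) (ZInt R i) (l + 1)) = (if Odd (l + 1) then 0 else 1) ∧
    pRank p (Abelian.Ext (ZInt R i) (ZInt R j) (l + 1)) = (if Odd (l + 1) then 1 else 0) := by
  induction l generalizing i j with
  | zero => simpa using ⟨pRank_ext_one_self R hp i, pRank_ext_one_of_ne hR hp hij hsim⟩
  | succ l ih =>
    have hsim' : SimP R p j i := fun r hr => (dvd_sub_comm).1 (hsim r hr)
    have hclass' : ∀ m : I, SimP R p j m → m = j ∨ m = i := fun m hm =>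
      (hclass m fun r hr => by simpa using dvd_add (hsim r hr) (hm r hr)).symm
    obtain ⟨h1, h2⟩ := ih hij.symm hsim' hclass'
    rw [pRank_ext_succ hR hp hij hsim hclass (Or.inl rfl),
      pRank_ext_succ hR hp hij hsim hclass (Or.inr rfl), h1, h2]
    simp only [Nat.odd_add_one (n := l + 1)]
    constructor <;> split_ifs <;> rfl

/-- Let `R ⊆ Gh(I)` be a B-ring, `p` a prime, and suppose distinct `i, j ∈ I` are such that
`{i, j}` is a full equivalence class of `∼_p` on `I`.  Writing `a_l`, `a'_l` for the
`p`-ranks of `Ext^l_R(ℤ_i, ℤ_i)` and `Ext^l_R(ℤ_i, ℤ_j)`, we have for all `l ≥ 1`: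
`a_l = 0` for `l` odd, `a_l = 1` for `l` even, while `a'_l = 1` for `l` odd and `a'_l = 0`
for `l` even. -/
theorem stmt_11 (I : Type) [Fintype I] (R : Subring (I → ℤ)) (hR : IsBRing R)
    (p : ℕ) (hp : p.Prime) (i j : I) (hij : i ≠ j) (hsim : SimP R p i j)
    (hclass : ∀ m : I, SimP R p i m → m = i ∨ m = j)
    (l : ℕ) (hl : 1 ≤ l) :
    pRank p (((Ext ℤ (ModuleCat R) l).obj (Opposite.op (ZInt R i))).obj (ZInt R i)) =
        (if Odd l then 0 else 1) ∧
    pRank p (((Ext ℤ (ModuleCat R) l).obj (Opposite.op (ZInt R i))).obj (ZInt R j)) =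
        (if Odd l then 1 else 0) := by
  obtain ⟨l, rfl⟩ := Nat.exists_eq_add_of_le' hl
  obtain ⟨e⟩ := nonempty_ext_addEquiv (ZInt R i) (ZInt R i) l
  obtain ⟨e'⟩ := nonempty_ext_addEquiv (ZInt R i) (ZInt R j) l
  rw [pRank_congr e, pRank_congr e']
  exact pRank_ext hR hp hij hsim hclass l
end
end
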